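/- (Theorem 1) A formula α ∈ L_PrŁ²Δ is Pr_Ł²Δ valid if and only if the formula (α^¬)^4 ∈ L_4PrŁΔ is 4PrŁΔ valid, where α^¬ is the ¬-normal form of α (pushing ¬ to modal atoms) and (·)^4 is the translation defined by (Pr φ)^4 = Bl φ ⊕ Cf φ, (∼α)^4 = ∼α^4, (Δα)^4 = Δα^4, (α→α')^4 = α^4 → α'^4. -/

import Mathlib

inductive BD : Type where
  | var : ℕ → BD
  | neg : BD → BD
  | and : BD → BD → BD
  | or  : BD → BD → BD

structure BDModel (W : Type) where
  vpos : ℕ → Set W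
  vneg : ℕ → Set W

mutual
  def suppT {W : Type} (M : BDModel W) : BD → W → Prop
    | .var p, w => w ∈ M.vpos p
    | .neg φ, w => suppF M φ w
    | .and φ χ, w => suppT M φ w ∧ suppT M χ w
    | .or φ χ, w => suppT M φ w ∨ suppT M χ w
  def suppF {W : Type} (M : BDModel W) : BD → W → Prop
    | .var p, w => w ∈ M.vneg p
    | .neg φ, w => suppT M φ w
    | .and φ χ, w => suppF M φ w ∨ suppF M χ w
    | .or φ χ, w => suppF M φ w ∧ suppF M χ w
end

def extP {W : Type} (M : BDModel W) (φ : BD) : Set W := {w | suppT M φ w}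
def extN {W : Type} (M : BDModel W) (φ : BD) : Set W := {w | suppF M φ w}

/-- A BD model (on a nonempty carrier) together with a ±-probability. -/
structure PrModel (W : Type) [Nonempty W] where
  M : BDModel W
  mu : Set W → ℝ
  mu_mem : ∀ X : Set W, mu X ∈ Set.Icc (0:ℝ) 1
  mon : ∀ X Y : Set W, X ⊆ Y → mu X ≤ mu Y
  negp : ∀ φ : BD, mu (extN M φ) = mu (extP M (.neg φ))
  ex : ∀ φ χ : BD,
    mu (extP M (.or φ χ)) = mu (extP M φ) + mu (extP M χ) - mu (extP M (.and φ χ))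

/-- The language L_PrŁ²Δ: α ::= Pr φ | ¬α | ∼α | Δα | (α→α). -/
inductive PrF : Type where
  | pr : BD → PrF
  | neg : PrF → PrF
  | snot : PrF → PrF
  | delta : PrF → PrF
  | imp : PrF → PrF → PrF

open Classical in
mutual
  /-- Support of truth e₁ in a Pr_Ł²Δ model. -/
  noncomputable def pe1 {W : Type} [Nonempty W] (P : PrModel W) : PrF → ℝ
    | .pr φ => P.mu (extP P.M φ)
    | .neg α => pe2 P α
    | .snot α => 1 - pe1 P α
    | .delta α => if pe1 P α = 1 then 1 else 0
    | .imp α β => min 1 (1 - pe1 P α + pe1 P β)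
  /-- Support of falsity e₂ in a Pr_Ł²Δ model. -/
  noncomputable def pe2 {W : Type} [Nonempty W] (P : PrModel W) : PrF → ℝ
    | .pr φ => P.mu (extN P.M φ)
    | .neg α => pe1 P α
    | .snot α => 1 - pe2 P α
    | .delta α => if pe2 P α = 0 then 0 else 1
    | .imp α β => max 0 (pe2 P β - pe2 P α)
end

/-- Pr_Ł²Δ validity: value (1,0) in every model. -/
def PrValid (α : PrF) : Prop :=
  ∀ (W : Type) (_ : Nonempty W) (P : PrModel W), pe1 P α = 1 ∧ pe2 P α = 0

/-- The ¬-normal form transformation pushing ¬ to modal atoms. -/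
def PrF.nnf : PrF → PrF
  | .pr φ => .pr φ
  | .snot α => .snot α.nnf
  | .delta α => .delta α.nnf
  | .imp α β => .imp α.nnf β.nnf
  | .neg (.pr φ) => .pr (.neg φ)
  | .neg (.neg α) => α.nnf
  | .neg (.snot α) => .snot (PrF.nnf (.neg α))
  | .neg (.imp α β) => .snot (.imp (PrF.nnf (.neg β)) (PrF.nnf (.neg α)))
  | .neg (.delta α) => .snot (.delta (.snot (PrF.nnf (.neg α))))

/-- Pure belief extension |φ|^b = |φ|⁺ ∖ |φ|⁻. -/
def extB {W : Type} (M : BDModel W) (φ : BD) : Set W := extP M φ \ extN M φ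
/-- Pure disbelief extension |φ|^d = |φ|⁻ ∖ |φ|⁺. -/
def extD {W : Type} (M : BDModel W) (φ : BD) : Set W := extN M φ \ extP M φ
/-- Conflict extension |φ|^c = |φ|⁺ ∩ |φ|⁻. -/
def extC {W : Type} (M : BDModel W) (φ : BD) : Set W := extP M φ ∩ extN M φ
/-- Uncertainty extension |φ|^u = W ∖ (|φ|⁺ ∪ |φ|⁻). -/
def extU {W : Type} (M : BDModel W) (φ : BD) : Set W := (extP M φ ∪ extN M φ)ᶜ

/-- A BD model (on a nonempty carrier) with a 4-probability. -/
structure FourModel (W : Type) [Nonempty W] where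
  M : BDModel W
  mu : Set W → ℝ
  mu_mem : ∀ X : Set W, mu X ∈ Set.Icc (0:ℝ) 1
  part : ∀ φ : BD, mu (extB M φ) + mu (extD M φ) + mu (extU M φ) + mu (extC M φ) = 1
  negb : ∀ φ : BD, mu (extB M (.neg φ)) = mu (extD M φ)
  negc : ∀ φ : BD, mu (extC M (.neg φ)) = mu (extC M φ)
  contrb : ∀ φ : BD, mu (extB M (.and φ (.neg φ))) = 0
  contrc : ∀ φ : BD, mu (extC M (.and φ (.neg φ))) = mu (extC M φ)
  bcmon : ∀ φ ψ : BD, extP M φ ⊆ extP M ψ → extN M ψ ⊆ extN M φ →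
    mu (extB M φ) + mu (extC M φ) ≤ mu (extB M ψ) + mu (extC M ψ)
  bcex : ∀ φ ψ : BD,
    mu (extB M φ) + mu (extC M φ) + mu (extB M ψ) + mu (extC M ψ) =
      mu (extB M (.and φ ψ)) + mu (extC M (.and φ ψ)) +
        mu (extB M (.or φ ψ)) + mu (extC M (.or φ ψ))

/-- The language L_4PrŁΔ: α ::= Bl φ | Db φ | Cf φ | Uc φ | ∼α | Δα | (α→α). -/
inductive FourF : Type where
  | bl : BD → FourF
  | db : BD → FourF
  | cf : BD → FourF
  | uc : BD → FourF
  | snot : FourF → FourF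
  | delta : FourF → FourF
  | imp : FourF → FourF → FourF

open Classical in
/-- Evaluation of L_4PrŁΔ formulas in a 4PrŁΔ model (standard Ł_Δ operations). -/
noncomputable def fe {W : Type} [Nonempty W] (F : FourModel W) : FourF → ℝ
  | .bl φ => F.mu (extB F.M φ)
  | .db φ => F.mu (extD F.M φ)
  | .cf φ => F.mu (extC F.M φ)
  | .uc φ => F.mu (extU F.M φ)
  | .snot α => 1 - fe F α
  | .delta α => if fe F α = 1 then 1 else 0
  | .imp α β => min 1 (1 - fe F α + fe F β)

/-- 4PrŁΔ validity: value 1 in every model. -/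
def FourValid (α : FourF) : Prop :=
  ∀ (W : Type) (_ : Nonempty W) (F : FourModel W), fe F α = 1

/-- α⊕β := ∼α→β in L_4PrŁΔ. -/
def FourF.oplus (α β : FourF) : FourF := .imp (.snot α) β
/-- α⊙β := ∼(α→∼β) in L_4PrŁΔ. -/
def FourF.odot (α β : FourF) : FourF := .snot (.imp α (.snot β))
/-- α⊖β := α⊙∼β in L_4PrŁΔ. -/
def FourF.ominus (α β : FourF) : FourF := α.odot (.snot β)
/-- α↔β := (α→β)⊙(β→α) in L_4PrŁΔ. -/
def FourF.biimp (α β : FourF) : FourF := FourF.odot (.imp α β) (.imp β α)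

/-- The translation (·)^4 of ¬-free L_PrŁ²Δ formulas into L_4PrŁΔ:
(Pr φ)^4 = Bl φ ⊕ Cf φ, commuting with ∼, Δ and →.
(The ¬ case is vacuous: the translation is applied to ¬-normal forms,
which are ¬-free.) -/
def PrF.toFour : PrF → FourF
  | .pr φ => FourF.oplus (.bl φ) (.cf φ)
  | .neg α => α.toFour
  | .snot α => .snot α.toFour
  | .delta α => .delta α.toFour
  | .imp α β => .imp α.toFour β.toFour

section Support

variable {W : Type} (M : BDModel W) (φ χ : BD)

theorem extP_neg : extP M (.neg φ) = extN M φ := by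
  ext w; simp [extP, extN, suppT]

theorem extN_neg : extN M (.neg φ) = extP M φ := by
  ext w; simp [extP, extN, suppF]

theorem extP_and : extP M (.and φ χ) = extP M φ ∩ extP M χ := by
  ext w; simp [extP, suppT]

theorem extN_and : extN M (.and φ χ) = extN M φ ∪ extN M χ := by
  ext w; simp [extN, suppF]

theorem extP_or : extP M (.or φ χ) = extP M φ ∪ extP M χ := by
  ext w; simp [extP, suppT]

theorem extN_or : extN M (.or φ χ) = extN M φ ∩ extN M χ := by
  ext w; simp [extN, suppF]

end Support

theorem fe_oplus_bl_cf {W : Type} [Nonempty W] (F : FourModel W) (φ : BD) :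
    fe F (FourF.oplus (.bl φ) (.cf φ)) = F.mu (extB F.M φ) + F.mu (extC F.M φ) := by
  have := F.part φ
  have := (F.mu_mem (extD F.M φ)).1
  have := (F.mu_mem (extU F.M φ)).1
  simp only [FourF.oplus, fe]
  rw [min_eq_right] <;> linarith

/-- If the two models agree on the modal atoms, then the translated `¬`-normal forms of `α` and
`¬α` have the values `e₁ α` and `e₂ α`. -/
theorem fe_toFour_nnf {W V : Type} [Nonempty W] [Nonempty V] (P : PrModel W) (F : FourModel V)
    (h : ∀ φ, F.mu (extB F.M φ) + F.mu (extC F.M φ) = P.mu (extP P.M φ)) (α : PrF) :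
    fe F α.nnf.toFour = pe1 P α ∧ fe F (PrF.neg α).nnf.toFour = pe2 P α := by
  induction α with
  | pr φ =>
    simp only [PrF.nnf, PrF.toFour, fe_oplus_bl_cf, h, pe1, pe2, P.negp, and_self]
  | neg α ih => exact ⟨by simpa [pe1] using ih.2, by simpa [PrF.nnf, pe2] using ih.1⟩
  | snot α ih => simp [PrF.nnf, PrF.toFour, fe, pe1, pe2, ih]
  | delta α ih =>
    simp only [PrF.nnf, PrF.toFour, fe, pe1, pe2, ih, sub_eq_self, true_and]
    split_ifs <;> simp
  | imp α β ihα ihβ =>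
    simp only [PrF.nnf, PrF.toFour, fe, pe1, pe2, ihα, ihβ, true_and]
    rcases le_total (pe2 P β) (pe2 P α) with hle | hle
    · rw [min_eq_left (by linarith), max_eq_left (by linarith)]; ring
    · rw [min_eq_right (by linarith), max_eq_right (by linarith)]; ring

section Conflation

/-- The conflation of a BD model. -/
def BDModel.conflation {W : Type} (M : BDModel W) : BDModel W where
  vpos p := (M.vneg p)ᶜ
  vneg p := (M.vpos p)ᶜ

theorem ext_conflation {W : Type} (M : BDModel W) (φ : BD) :
    extP M.conflation φ = (extN M φ)ᶜ ∧ extN M.conflation φ = (extP M φ)ᶜ := by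
  induction φ with
  | var p => constructor <;> ext w <;> simp [extP, extN, suppT, suppF, BDModel.conflation]
  | neg φ ih => simp [extP_neg, extN_neg, ih]
  | and φ χ ihφ ihχ => simp [extP_and, extN_and, ihφ, ihχ, Set.compl_inter, Set.compl_union]
  | or φ χ ihφ ihχ => simp [extP_or, extN_or, ihφ, ihχ, Set.compl_inter, Set.compl_union]

variable {W : Type} [Nonempty W]

/-- The conflation of a `±`-probability: the dual set function on the conflated model. -/
def PrModel.conflation (P : PrModel W) : PrModel W where
  M := P.M.conflation
  mu X := 1 - P.mu Xᶜ
  mu_mem X := by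
    have := P.mu_mem Xᶜ
    exact ⟨by linarith [this.2], by linarith [this.1]⟩
  mon X Y h := by
    have := P.mon Yᶜ Xᶜ (Set.compl_subset_compl.2 h)
    linarith
  negp φ := by rw [extP_neg]
  ex φ χ := by
    have := P.ex (.neg φ) (.neg χ)
    simp only [extP_or, extP_and, extP_neg] at this
    simp only [(ext_conflation _ _).1, compl_compl, extN_or, extN_and]
    linarith

theorem pe_conflation (P : PrModel W) (α : PrF) :
    pe1 P.conflation α = 1 - pe2 P α ∧ pe2 P.conflation α = 1 - pe1 P α := by
  induction α with
  | pr φ => simp [pe1, pe2, PrModel.conflation, ext_conflation]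
  | neg α ih => simp [pe1, pe2, ih]
  | snot α ih => simp [pe1, pe2, ih]
  | delta α ih =>
    simp only [pe1, pe2, ih, sub_eq_self, sub_eq_zero, eq_comm (a := (1 : ℝ)) (b := pe1 P α)]
    constructor <;> split_ifs <;> simp
  | imp α β ihα ihβ =>
    simp only [pe1, pe2, ihα, ihβ]
    constructor
    · rcases le_total (pe2 P β) (pe2 P α) with hle | hle
      · rw [min_eq_left (by linarith), max_eq_left (by linarith)]; ring
      · rw [min_eq_right (by linarith), max_eq_right (by linarith)]; ring
    · rcases le_total (pe1 P α) (pe1 P β) with hle | hle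
      · rw [min_eq_left (by linarith), max_eq_left (by linarith)]; ring
      · rw [min_eq_right (by linarith), max_eq_right (by linarith)]; ring

end Conflation

section FourToPr

/-- The disjoint sum of a BD model with its conflation. -/
def BDModel.double {W : Type} (M : BDModel W) : BDModel (W ⊕ W) where
  vpos p := Sum.elim (M.vpos p) (M.vneg p)ᶜ
  vneg p := Sum.elim (M.vneg p) (M.vpos p)ᶜ

theorem supp_double {W : Type} (M : BDModel W) (φ : BD) :
    (∀ w, (suppT M.double φ (.inl w) ↔ suppT M φ w) ∧ (suppF M.double φ (.inl w) ↔ suppF M φ w)) ∧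
    ∀ w, (suppT M.double φ (.inr w) ↔ ¬ suppF M φ w) ∧
      (suppF M.double φ (.inr w) ↔ ¬ suppT M φ w) := by
  induction φ with
  | var p =>
    simp only [suppT, suppF]
    exact ⟨fun w => ⟨Iff.rfl, Iff.rfl⟩, fun w => ⟨Iff.rfl, Iff.rfl⟩⟩
  | neg φ ih => simp only [suppT, suppF, ih, implies_true, and_self]
  | and φ χ ihφ ihχ =>
    simp only [suppT, suppF, ihφ, ihχ, not_or, not_and_or, implies_true, and_self]
  | or φ χ ihφ ihχ =>
    simp only [suppT, suppF, ihφ, ihχ, not_or, not_and_or, implies_true, and_self]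

theorem extP_double_subset {W : Type} {M : BDModel W} {φ ψ : BD}
    (h : extP M.double φ ⊆ extP M.double ψ) :
    extP M φ ⊆ extP M ψ ∧ extN M ψ ⊆ extN M φ := by
  constructor
  · intro w hw
    exact ((supp_double M ψ).1 w).1.1 (h (((supp_double M φ).1 w).1.2 hw))
  · intro w hw
    by_contra hn
    exact ((supp_double M ψ).2 w).1.1 (h (((supp_double M φ).2 w).1.2 hn)) hw

variable {W : Type} [Nonempty W] (F : FourModel W)

/-- The inner set function induced by `φ ↦ μ₄(|φ|^b) + μ₄(|φ|^c)` on the doubled model. -/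
noncomputable def FourModel.inner (X : Set (W ⊕ W)) : ℝ :=
  ⨆ φ : {φ : BD // extP F.M.double φ ⊆ X}, (F.mu (extB F.M φ) + F.mu (extC F.M φ))

theorem FourModel.bc_mem (φ : BD) :
    F.mu (extB F.M φ) + F.mu (extC F.M φ) ∈ Set.Icc (0 : ℝ) 1 := by
  have := F.part φ
  have := (F.mu_mem (extB F.M φ)).1
  have := (F.mu_mem (extC F.M φ)).1
  have := (F.mu_mem (extD F.M φ)).1
  have := (F.mu_mem (extU F.M φ)).1
  constructor <;> linarith

theorem FourModel.bddAbove_bc (X : Set (W ⊕ W)) :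
    BddAbove (Set.range fun φ : {φ : BD // extP F.M.double φ ⊆ X} =>
      F.mu (extB F.M φ) + F.mu (extC F.M φ)) :=
  ⟨1, by rintro _ ⟨φ, rfl⟩; exact (F.bc_mem φ).2⟩

theorem FourModel.inner_mem (X : Set (W ⊕ W)) : F.inner X ∈ Set.Icc (0 : ℝ) 1 :=
  ⟨Real.iSup_nonneg fun φ => (F.bc_mem φ).1,
    Real.iSup_le (fun φ => (F.bc_mem φ).2) zero_le_one⟩

theorem FourModel.inner_mono {X Y : Set (W ⊕ W)} (h : X ⊆ Y) : F.inner X ≤ F.inner Y :=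
  Real.iSup_le (fun φ => le_ciSup (F.bddAbove_bc Y) ⟨φ.1, φ.2.trans h⟩) (F.inner_mem Y).1

theorem FourModel.inner_extP (φ : BD) :
    F.inner (extP F.M.double φ) = F.mu (extB F.M φ) + F.mu (extC F.M φ) := by
  apply le_antisymm
  · refine Real.iSup_le (fun ψ => ?_) (F.bc_mem φ).1
    exact F.bcmon _ _ (extP_double_subset ψ.2).1 (extP_double_subset ψ.2).2
  · exact le_ciSup (F.bddAbove_bc _) ⟨φ, subset_rfl⟩

/-- The `±`-probability on the doubled model induced by a 4-probability. -/
noncomputable def FourModel.toPr : PrModel (W ⊕ W) where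
  M := F.M.double
  mu := F.inner
  mu_mem := F.inner_mem
  mon _ _ := F.inner_mono
  negp φ := by rw [extP_neg]
  ex φ χ := by
    have := F.bcex φ χ
    simp only [F.inner_extP]
    linarith

end FourToPr

section PrToFour

/-- A BD model with one additional state supporting both the truth and the falsity of every
variable (`inr true`) and one supporting neither (`inr false`). -/
def BDModel.extend {W : Type} (M : BDModel W) : BDModel (W ⊕ Bool) where
  vpos p := {x | Sum.elim (· ∈ M.vpos p) (· = true) x}
  vneg p := {x | Sum.elim (· ∈ M.vneg p) (· = true) x}

theorem supp_extend {W : Type} (M : BDModel W) (φ : BD) :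
    (∀ w, (suppT M.extend φ (.inl w) ↔ suppT M φ w) ∧ (suppF M.extend φ (.inl w) ↔ suppF M φ w)) ∧
    ∀ b, (suppT M.extend φ (.inr b) ↔ b = true) ∧ (suppF M.extend φ (.inr b) ↔ b = true) := by
  induction φ with
  | var p => simp [suppT, suppF, BDModel.extend]
  | neg φ ih => simp only [suppT, suppF, ih, implies_true, and_self]
  | and φ χ ihφ ihχ => simp only [suppT, suppF, ihφ, ihχ, or_self, implies_true, and_self]
  | or φ χ ihφ ihχ => simp only [suppT, suppF, ihφ, ihχ, or_self, implies_true, and_self]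

variable {W : Type}

theorem extB_extend (M : BDModel W) (φ : BD) : extB M.extend φ = Sum.inl '' extB M φ := by
  ext (w | b) <;> simp [extB, extP, extN, supp_extend]

theorem extC_extend (M : BDModel W) (φ : BD) :
    extC M.extend φ = insert (.inr true) (Sum.inl '' extC M φ) := by
  ext (w | b) <;> simp [extC, extP, extN, supp_extend]

theorem extU_extend (M : BDModel W) (φ : BD) :
    extU M.extend φ = insert (.inr false) (Sum.inl '' extU M φ) := by
  ext (w | b) <;> simp [extU, extP, extN, supp_extend]

theorem extP_and_neg (M : BDModel W) (φ : BD) : extP M (.and φ (.neg φ)) = extC M φ := by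
  rw [extP_and, extP_neg, extC]

theorem extB_neg (M : BDModel W) (φ : BD) : extB M (.neg φ) = extD M φ := by
  rw [extB, extP_neg, extN_neg, extD]

theorem extC_neg (M : BDModel W) (φ : BD) : extC M (.neg φ) = extC M φ := by
  rw [extC, extP_neg, extN_neg, extC, Set.inter_comm]

theorem extC_and_neg (M : BDModel W) (φ : BD) : extC M (.and φ (.neg φ)) = extC M φ := by
  ext w
  simp only [extC, extP_and, extN_and, extP_neg, extN_neg, Set.mem_inter_iff, Set.mem_union]
  tauto

variable [Nonempty W] (P : PrModel W)

theorem PrModel.extP_sub_extC_congr {φ ψ : BD} (h : extB P.M φ = extB P.M ψ) :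
    P.mu (extP P.M φ) - P.mu (extC P.M φ) = P.mu (extP P.M ψ) - P.mu (extC P.M ψ) := by
  have h₁ := P.ex φ (.and ψ (.neg ψ))
  have h₂ := P.ex ψ (.and φ (.neg φ))
  rw [extP_or, extP_and _ φ, extP_and_neg] at h₁
  rw [extP_or, extP_and _ ψ, extP_and_neg] at h₂
  have hiff : ∀ w, (w ∈ extP P.M φ ∧ w ∉ extN P.M φ) ↔ (w ∈ extP P.M ψ ∧ w ∉ extN P.M ψ) :=
    fun w => Set.ext_iff.1 h w
  have hu : extP P.M φ ∪ extC P.M ψ = extP P.M ψ ∪ extC P.M φ := by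
    ext w
    have := hiff w
    simp only [extC, Set.mem_union, Set.mem_inter_iff]
    tauto
  have hi : extP P.M φ ∩ extC P.M ψ = extP P.M ψ ∩ extC P.M φ := by
    ext w
    have := hiff w
    simp only [extC, Set.mem_inter_iff]
    tauto
  rw [hu, hi] at h₁
  linarith

theorem PrModel.extP_sub_extC_mem (φ : BD) :
    P.mu (extP P.M φ) - P.mu (extC P.M φ) ∈ Set.Icc (0 : ℝ) 1 := by
  have h₁ : P.mu (extC P.M φ) ≤ P.mu (extP P.M φ) := P.mon _ _ Set.inter_subset_left
  have h₂ := (P.mu_mem (extP P.M φ)).2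
  have h₃ := (P.mu_mem (extC P.M φ)).1
  constructor <;> linarith

open Classical in
/-- The set function on the extended model that induces a 4-probability: sets containing
`inr true` are measured as conflict extensions, sets containing `inr false` as uncertainty
extensions, and all others as pure belief extensions. -/
noncomputable def PrModel.fourMu (X : Set (W ⊕ Bool)) : ℝ :=
  if .inr true ∈ X then P.mu (Sum.inl ⁻¹' X)
  else if .inr false ∈ X then 1 - P.mu (Sum.inl ⁻¹' X)ᶜ
  else if h : ∃ φ, extB P.M φ = Sum.inl ⁻¹' X then
    P.mu (extP P.M h.choose) - P.mu (extC P.M h.choose)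
  else 0

theorem PrModel.fourMu_mem (X : Set (W ⊕ Bool)) : P.fourMu X ∈ Set.Icc (0 : ℝ) 1 := by
  unfold PrModel.fourMu
  split_ifs with _ _ h
  · exact P.mu_mem _
  · have := P.mu_mem (Sum.inl ⁻¹' X)ᶜ
    exact ⟨by linarith [this.2], by linarith [this.1]⟩
  · exact P.extP_sub_extC_mem _
  · simp

theorem PrModel.fourMu_extB (φ : BD) :
    P.fourMu (extB P.M.extend φ) = P.mu (extP P.M φ) - P.mu (extC P.M φ) := by
  have hpre : Sum.inl ⁻¹' extB P.M.extend φ = extB P.M φ := by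
    rw [extB_extend, Set.preimage_image_eq _ Sum.inl_injective]
  have h : ∃ ψ, extB P.M ψ = Sum.inl ⁻¹' extB P.M.extend φ := ⟨φ, hpre.symm⟩
  rw [PrModel.fourMu, if_neg (by simp [extB_extend]), if_neg (by simp [extB_extend]), dif_pos h]
  exact P.extP_sub_extC_congr (h.choose_spec.trans hpre)

theorem PrModel.fourMu_extC (φ : BD) : P.fourMu (extC P.M.extend φ) = P.mu (extC P.M φ) := by
  rw [PrModel.fourMu, if_pos (by simp [extC_extend])]
  congr 1
  ext w
  simp [extC_extend]

theorem PrModel.fourMu_extU (φ : BD) :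
    P.fourMu (extU P.M.extend φ) = 1 - P.mu (extP P.M φ ∪ extN P.M φ) := by
  rw [PrModel.fourMu, if_neg (by simp [extU_extend]), if_pos (by simp [extU_extend])]
  congr 2
  ext w
  simp [extU_extend, extU.eq_1 P.M, or_iff_not_imp_left]

theorem PrModel.fourMu_extB_add_extC (φ : BD) :
    P.fourMu (extB P.M.extend φ) + P.fourMu (extC P.M.extend φ) = P.mu (extP P.M φ) := by
  rw [P.fourMu_extB, P.fourMu_extC, sub_add_cancel]

/-- The 4-probability on the extended model induced by a `±`-probability. -/
noncomputable def PrModel.toFourModel : FourModel (W ⊕ Bool) where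
  M := P.M.extend
  mu := P.fourMu
  mu_mem := P.fourMu_mem
  part φ := by
    have h := P.ex φ (.neg φ)
    rw [extP_or, extP_and_neg, extP_neg] at h
    rw [← extB_neg, P.fourMu_extB, P.fourMu_extB, P.fourMu_extU, P.fourMu_extC, extP_neg, extC_neg]
    linarith
  negb φ := by rw [extB_neg]
  negc φ := by rw [extC_neg]
  contrb φ := by rw [P.fourMu_extB, extP_and_neg, extC_and_neg, sub_self]
  contrc φ := by rw [extC_and_neg]
  bcmon φ ψ h _ := by
    rw [P.fourMu_extB_add_extC, P.fourMu_extB_add_extC]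
    refine P.mon _ _ fun w hw => ?_
    exact ((supp_extend P.M ψ).1 w).1.1 (h (((supp_extend P.M φ).1 w).1.2 hw))
  bcex φ ψ := by
    have h := P.ex φ ψ
    simp only [← P.fourMu_extB_add_extC] at h
    linarith

end PrToFour

/-- Theorem 1: α is Pr_Ł²Δ valid iff (α^¬)^4 is 4PrŁΔ valid. -/
theorem PrValid_iff_toFour_nnf_FourValid (α : PrF) :
    PrValid α ↔ FourValid α.nnf.toFour := by
  constructor
  · intro h W _ F
    rw [(fe_toFour_nnf F.toPr F (fun φ => (F.inner_extP φ).symm) α).1]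
    exact (h _ inferInstance F.toPr).1
  · intro h
    have h_one : ∀ (W : Type) [Nonempty W] (P : PrModel W), pe1 P α = 1 := by
      intro W _ P
      rw [← (fe_toFour_nnf P P.toFourModel P.fourMu_extB_add_extC α).1]
      exact h _ inferInstance P.toFourModel
    intro W _ P
    refine ⟨h_one W P, ?_⟩
    have h_dual := h_one W P.conflation
    rw [(pe_conflation P α).1] at h_dual
    linarith
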